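/- arXiv:1110.4573 — 6 statements merged into one kernel-verified Lean document; each statement's English description precedes it below -/
import Mathlib

section
/- Let r, V_i, V_c, V_f, V_r, E, F be natural numbers such that r ≥ 4, 2E = 4V_i + 2V_c + 3V_f + 4V_r, rF + (V_c + V_f + V_r) = 2E, and (V_i + V_c + V_f + V_r) + F = E + 1. Then V_c ≥ r. -/
/-- Arithmetic core of the lemma that a closed simple path in a regular
`{r,4}`-tiling of the plane has at least `r` convex vertices. -/
theorem convex_vertices_ge (r Vi Vc Vf Vr E F : ℕ)
    (hr : 4 ≤ r)
    (hVE : 2 * E = 4 * Vi + 2 * Vc + 3 * Vf + 4 * Vr)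
    (hFE : r * F + (Vc + Vf + Vr) = 2 * E)
    (hEuler : (Vi + Vc + Vf + Vr) + F = E + 1) :
    r ≤ Vc := by
  obtain ⟨k, rfl⟩ := Nat.exists_eq_add_of_le hr
  obtain ⟨m, rfl⟩ : ∃ m, F = 1 + m := Nat.exists_eq_add_of_le (by omega)
  have hmul : (4 + k) * (1 + m) = 4 + k + 4 * m + k * m := by ring
  rw [hmul] at hFE
  omega
end

section
/- In the one-relator group G presented by four generators a, b, c, d and the single relator a·b·c·d·a⁻¹·b⁻¹·c⁻¹·d⁻¹, the identity (d·c·b)·(d·c·b) = (a·b·c·d)·(b·c·d·a⁻¹) holds. -/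
/-- The relator `a·b·c·d·a⁻¹·b⁻¹·c⁻¹·d⁻¹` of the fundamental group of the
closed orientable surface of genus 2, in the free group on four generators. -/
def genus2Rel : FreeGroup (Fin 4) :=
  FreeGroup.of 0 * FreeGroup.of 1 * FreeGroup.of 2 * FreeGroup.of 3 *
    (FreeGroup.of 0)⁻¹ * (FreeGroup.of 1)⁻¹ * (FreeGroup.of 2)⁻¹ * (FreeGroup.of 3)⁻¹

/-- The one-relator group `⟨a,b,c,d ; abcda⁻¹b⁻¹c⁻¹d⁻¹⟩`. -/
abbrev Genus2Group : Type := PresentedGroup ({genus2Rel} : Set (FreeGroup (Fin 4)))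

/-- The defining relation of `Genus2Group`, in the form `abcd = dcba`. -/
theorem Genus2Group.relation :
    (PresentedGroup.of 0 * PresentedGroup.of 1 * PresentedGroup.of 2 * PresentedGroup.of 3 :
        Genus2Group) =
      PresentedGroup.of 3 * PresentedGroup.of 2 * PresentedGroup.of 1 * PresentedGroup.of 0 := by
  have h : (PresentedGroup.of 0 * PresentedGroup.of 1 * PresentedGroup.of 2 *
      PresentedGroup.of 3 * (PresentedGroup.of 0)⁻¹ * (PresentedGroup.of 1)⁻¹ *
        (PresentedGroup.of 2)⁻¹ * (PresentedGroup.of 3)⁻¹ : Genus2Group) = 1 :=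
    PresentedGroup.one_of_mem (Set.mem_singleton genus2Rel)
  simpa only [mul_inv_eq_iff_eq_mul, one_mul] using h

/-- In `⟨a,b,c,d ; abcda⁻¹b⁻¹c⁻¹d⁻¹⟩` the identity
`(d·c·b)·(d·c·b) = (a·b·c·d)·(b·c·d·a⁻¹)` holds. -/
theorem genus2_w1_eq_w2 :
    ((PresentedGroup.of 3 : Genus2Group) * PresentedGroup.of 2 * PresentedGroup.of 1) *
        (PresentedGroup.of 3 * PresentedGroup.of 2 * PresentedGroup.of 1) =
      (PresentedGroup.of 0 * PresentedGroup.of 1 * PresentedGroup.of 2 * PresentedGroup.of 3) *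
        (PresentedGroup.of 1 * PresentedGroup.of 2 * PresentedGroup.of 3 *
          (PresentedGroup.of 0 : Genus2Group)⁻¹) := by
  have h := Genus2Group.relation
  have hconj := mul_inv_eq_of_eq_mul h
  rw [h]
  nth_rewrite 2 [← hconj]
  simp only [mul_assoc]
end

section
/- In the one-relator group K presented by two generators a, b and the single relator a·b·a·b⁻¹, every element g of K can be written in the canonical form g = a^u · b^v for some integers u and v. -/
/-- The relator `a·b·a·b⁻¹` of the Klein bottle group, in the free group on
two generators. -/
def kleinRel : FreeGroup (Fin 2) :=
  FreeGroup.of 0 * FreeGroup.of 1 * FreeGroup.of 0 * (FreeGroup.of 1)⁻¹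

/-- The one-relator group `⟨a,b ; abab⁻¹⟩`, the fundamental group of the
Klein bottle. -/
abbrev KleinGroup : Type := PresentedGroup ({kleinRel} : Set (FreeGroup (Fin 2)))

/-- The image of the generator `a` in the Klein bottle group. -/
def kA : KleinGroup := PresentedGroup.of 0

/-- The image of the generator `b` in the Klein bottle group. -/
def kB : KleinGroup := PresentedGroup.of 1

theorem kB_semiconjBy_kA : SemiconjBy kB kA kA⁻¹ := by
  have h : kA * kB * kA * kB⁻¹ = 1 :=
    PresentedGroup.one_of_mem (rels := {kleinRel}) (Set.mem_singleton kleinRel)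
  rw [SemiconjBy, eq_inv_mul_iff_mul_eq, ← mul_assoc]
  exact mul_inv_eq_one.mp h

theorem kB_mul_kA_zpow (u : ℤ) : kB * kA ^ u = kA ^ (-u) * kB := by
  simpa using (kB_semiconjBy_kA.zpow_right u).eq

theorem kB_inv_mul_kA_zpow (u : ℤ) : kB⁻¹ * kA ^ u = kA ^ (-u) * kB⁻¹ := by
  rw [inv_mul_eq_iff_eq_mul, ← mul_assoc, kB_mul_kA_zpow, neg_neg, mul_inv_cancel_right]

/-- Every element of `⟨a,b ; abab⁻¹⟩` can be written in the canonical form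
`a^u · b^v` with `u v : ℤ`. -/
theorem klein_canonical_form (g : KleinGroup) : ∃ u v : ℤ, g = kA ^ u * kB ^ v := by
  have hg : g ∈ Subgroup.closure (Set.range PresentedGroup.of) := by
    rw [PresentedGroup.closure_range_of]
    exact Subgroup.mem_top g
  induction hg using Subgroup.closure_induction_left with
  | one => exact ⟨0, 0, by simp⟩
  | mul_left x hx y _ ih =>
    obtain ⟨i, rfl⟩ := hx
    obtain ⟨u, v, rfl⟩ := ih
    fin_cases i
    · exact ⟨1 + u, v, by rw [zpow_one_add, mul_assoc]; rfl⟩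
    · refine ⟨-u, 1 + v, ?_⟩
      change kB * _ = _
      rw [← mul_assoc, kB_mul_kA_zpow, zpow_one_add, mul_assoc]
  | inv_mul_cancel x hx y _ ih =>
    obtain ⟨i, rfl⟩ := hx
    obtain ⟨u, v, rfl⟩ := ih
    fin_cases i
    · exact ⟨-1 + u, v, by rw [zpow_add, zpow_neg_one, mul_assoc]; rfl⟩
    · refine ⟨-u, -1 + v, ?_⟩
      change kB⁻¹ * _ = _
      rw [← mul_assoc, kB_inv_mul_kA_zpow, zpow_add kB, zpow_neg_one, mul_assoc]
end

section
/- In the one-relator group K presented by two generators a, b and the single relator a·b·a·b⁻¹, the canonical form is unique: if a^u · b^v = a^{u'} · b^{v'} for integers u, v, u', v', then u = u' and v = v'. -/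
/-- The translation `(x, y) ↦ (x + 1, y)` of the integer lattice. -/
def kleinTranslation : Equiv.Perm (ℤ × ℤ) :=
  (Equiv.addRight 1).prodCongr (Equiv.refl ℤ)

/-- The glide reflection `(x, y) ↦ (-x, y + 1)` of the integer lattice. -/
def kleinGlide : Equiv.Perm (ℤ × ℤ) :=
  (Equiv.neg ℤ).prodCongr (Equiv.addRight 1)

theorem kleinTranslation_zpow_apply (n x y : ℤ) :
    (kleinTranslation ^ n) (x, y) = (x + n, y) := by
  induction n generalizing x with
  | zero => simp
  | succ n ih =>
    rw [zpow_add_one, Equiv.Perm.mul_apply]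
    change (kleinTranslation ^ (n : ℤ)) (x + 1, y) = _
    rw [ih, add_assoc, add_comm 1]
  | pred n ih =>
    rw [zpow_sub_one, Equiv.Perm.mul_apply]
    change (kleinTranslation ^ (-n : ℤ)) (x + -1, y) = _
    rw [ih, add_assoc, add_comm (-1), sub_eq_add_neg]

theorem kleinGlide_zpow_apply (n y : ℤ) :
    (kleinGlide ^ n) (0, y) = (0, y + n) := by
  induction n generalizing y with
  | zero => simp
  | succ n ih =>
    rw [zpow_add_one, Equiv.Perm.mul_apply]
    change (kleinGlide ^ (n : ℤ)) (0, y + 1) = _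
    rw [ih, add_assoc, add_comm 1]
  | pred n ih =>
    rw [zpow_sub_one, Equiv.Perm.mul_apply]
    change (kleinGlide ^ (-n : ℤ)) (0, y + -1) = _
    rw [ih, add_assoc, add_comm (-1), sub_eq_add_neg]

theorem kleinTranslation_glide_relation :
    kleinTranslation * kleinGlide * kleinTranslation * kleinGlide⁻¹ = 1 := by
  rw [mul_inv_eq_one]
  ext ⟨x, y⟩ <;> simp [kleinTranslation, kleinGlide]

/-- The action of the Klein bottle group on the integer lattice. -/
def kleinLatticeAction : KleinGroup →* Equiv.Perm (ℤ × ℤ) :=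
  PresentedGroup.toGroup (f := ![kleinTranslation, kleinGlide]) <| by
    rintro r rfl
    simpa [kleinRel] using kleinTranslation_glide_relation

theorem kleinLatticeAction_canonical_form (u v : ℤ) :
    kleinLatticeAction (kA ^ u * kB ^ v) (0, 0) = (u, v) := by
  have hA : kleinLatticeAction kA = kleinTranslation := PresentedGroup.toGroup.of _
  have hB : kleinLatticeAction kB = kleinGlide := PresentedGroup.toGroup.of _
  rw [map_mul, map_zpow, map_zpow, hA, hB, Equiv.Perm.mul_apply, kleinGlide_zpow_apply,
    kleinTranslation_zpow_apply, zero_add, zero_add]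

/-- Uniqueness of the canonical form `a^u · b^v` in `⟨a,b ; abab⁻¹⟩`. -/
theorem klein_canonical_form_unique (u v u' v' : ℤ)
    (h : kA ^ u * kB ^ v = kA ^ u' * kB ^ v') : u = u' ∧ v = v' := by
  rw [← Prod.mk.injEq, ← kleinLatticeAction_canonical_form u v, h,
    kleinLatticeAction_canonical_form]
end

section
/- In the one-relator group K presented by two generators a, b and the single relator a·b·a·b⁻¹, if the elements a^u · b^v and a^{u'} · b^{v'} (with u, v, u', v' integers) are conjugate in K, then v = v'. -/
/-- The exponent sum of `b`, as a homomorphism from the Klein bottle group to `ℤ`. -/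
def kleinExponentB : KleinGroup →* Multiplicative ℤ :=
  PresentedGroup.toGroup (f := ![1, Multiplicative.ofAdd 1]) (by
    rintro r rfl
    simp [kleinRel])

lemma kleinExponentB_kA : kleinExponentB kA = 1 :=
  PresentedGroup.toGroup.of _

lemma kleinExponentB_kB : kleinExponentB kB = Multiplicative.ofAdd 1 :=
  PresentedGroup.toGroup.of _

/-- If `a^u · b^v` and `a^u' · b^v'` are conjugate in `⟨a,b ; abab⁻¹⟩`,
then `v = v'`. -/
theorem klein_conj_exponent_eq (u v u' v' : ℤ)
    (h : IsConj (kA ^ u * kB ^ v) (kA ^ u' * kB ^ v')) : v = v' := by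
  have key := isConj_iff_eq.mp (kleinExponentB.map_isConj h)
  simpa [kleinExponentB_kA, kleinExponentB_kB, ← ofAdd_zsmul] using key
end

section
/- In the one-relator group K presented by two generators a, b and the single relator a·b·a·b⁻¹, if the elements a^u · b^v and a^{u'} · b^{v'} (with u, v, u', v' integers) are conjugate in K, then u and u' have the same parity, i.e. u ≡ u' (mod 2). -/
/-- The parity homomorphism of the Klein bottle group, sending `a` to `1` and `b` to `0`
in `ℤ/2`. -/
def kleinParity : KleinGroup →* Multiplicative (ZMod 2) :=
  PresentedGroup.toGroup (f := ![Multiplicative.ofAdd 1, 1]) (by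
    rintro r rfl
    simp only [kleinRel, map_mul, map_inv, FreeGroup.lift_apply_of]
    decide)

theorem kleinParity_kA : kleinParity kA = Multiplicative.ofAdd 1 :=
  PresentedGroup.toGroup.of _

theorem kleinParity_kB : kleinParity kB = 1 :=
  PresentedGroup.toGroup.of _

theorem kleinParity_zpow_mul_zpow (u v : ℤ) :
    kleinParity (kA ^ u * kB ^ v) = Multiplicative.ofAdd (u : ZMod 2) := by
  rw [map_mul, map_zpow, map_zpow, kleinParity_kA, kleinParity_kB, one_zpow, mul_one,
    ← ofAdd_zsmul, zsmul_one]

/-- If `a^u · b^v` and `a^u' · b^v'` are conjugate in `⟨a,b ; abab⁻¹⟩`,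
then `u ≡ u' (mod 2)`. -/
theorem klein_conj_parity (u v u' v' : ℤ)
    (h : IsConj (kA ^ u * kB ^ v) (kA ^ u' * kB ^ v')) : u ≡ u' [ZMOD 2] := by
  have hp := isConj_iff_eq.mp (kleinParity.map_isConj h)
  rw [kleinParity_zpow_mul_zpow, kleinParity_zpow_mul_zpow] at hp
  exact (ZMod.intCast_eq_intCast_iff u u' 2).mp (Multiplicative.ofAdd.injective hp)
end
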